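/- Let X be a Banach space and let (Y₁;M,N;Y₂) be a Fredholm tetrad of closed linear subspaces of X. Then there exists ε > 0 such that for every tetrad (Y₁′;M′,N′;Y₂′) of closed linear subspaces of X with Y₁′ ⊆ M′∩N′ ⊆ M′+N′ ⊆ Y₂′ and δ̂(Y₁′,Y₁) < ε, δ̂(M′,M) < ε, δ̂(N′,N) < ε, δ̂(Y₂′,Y₂) < ε, the tetrad (Y₁′;M′,N′;Y₂′) is Fredholm and Index(Y₁′;M′,N′;Y₂′) = Index(Y₁;M,N;Y₂). -/

import Mathlib

open scoped Classical

/-- The gap `δ(M,N)` between two linear subspaces of a normed space: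
`δ(M,N) = sup_{u ∈ M, ‖u‖ = 1} dist(u, N)` (and `0` if `M = {0}`,
since the supremum of the empty set of reals is `0`). -/
noncomputable def gapSub {X : Type*} [NormedAddCommGroup X] [NormedSpace ℂ X]
    (M N : Submodule ℂ X) : ℝ :=
  sSup ((fun u => Metric.infDist u (N : Set X)) '' {u : X | u ∈ M ∧ ‖u‖ = 1})

/-- The symmetric gap `δ̂(M,N) = max (δ(M,N), δ(N,M))`. -/
noncomputable def hatGap {X : Type*} [NormedAddCommGroup X] [NormedSpace ℂ X]
    (M N : Submodule ℂ X) : ℝ :=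
  max (gapSub M N) (gapSub N M)

/-- The minimum gap `γ(M,N)`: the infimum of `dist(u,N)/dist(u, M ⊓ N)` over
`u ∈ M \ N`, and `1` if `M ⊆ N`. -/
noncomputable def minGap {X : Type*} [NormedAddCommGroup X] [NormedSpace ℂ X]
    (M N : Submodule ℂ X) : ℝ :=
  if M ≤ N then 1
  else sInf ((fun u => Metric.infDist u (N : Set X) /
      Metric.infDist u ((M ⊓ N : Submodule ℂ X) : Set X)) '' {u : X | u ∈ M ∧ u ∉ N})

/-- The rank (dimension, as a cardinal) of the quotient `B / A` for submodules
`A ≤ B` of `X`. -/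
noncomputable def quotRank {X : Type*} [NormedAddCommGroup X] [NormedSpace ℂ X]
    (A B : Submodule ℂ X) : Cardinal :=
  Module.rank ℂ (↥B ⧸ A.comap B.subtype)

/-- The quotient `B / A` is finite dimensional. -/
def QuotFin {X : Type*} [NormedAddCommGroup X] [NormedSpace ℂ X]
    (A B : Submodule ℂ X) : Prop :=
  FiniteDimensional ℂ (↥B ⧸ A.comap B.subtype)

/-- The finite dimension of the quotient `B / A`. -/
noncomputable def quotFinrank {X : Type*} [NormedAddCommGroup X] [NormedSpace ℂ X]
    (A B : Submodule ℂ X) : ℕ :=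
  Module.finrank ℂ (↥B ⧸ A.comap B.subtype)

/-- The dimension of the quotient `B / A` as an extended real:
the finrank if finite dimensional, `+∞` otherwise. -/
noncomputable def eQuotDim {X : Type*} [NormedAddCommGroup X] [NormedSpace ℂ X]
    (A B : Submodule ℂ X) : EReal :=
  if QuotFin A B then ((quotFinrank A B : ℝ) : EReal) else ⊤

/-- The index of a tetrad `(Y₁; M, N; Y₂)`:
`Index(Y₁; M, N; Y₂) = dim((M ∩ N)/Y₁) − dim(Y₂/(M + N))`, valued in `ℤ ∪ {±∞}`. -/
noncomputable def tetradIndex {X : Type*} [NormedAddCommGroup X] [NormedSpace ℂ X]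
    (Y₁ M N Y₂ : Submodule ℂ X) : EReal :=
  eQuotDim Y₁ (M ⊓ N) - eQuotDim (M ⊔ N) Y₂

/-- Iterative improvement of approximate preimages. -/
theorem iter_preimage {E F : Type*} [NormedAddCommGroup E] [NormedSpace ℂ E] [CompleteSpace E]
    [NormedAddCommGroup F] [NormedSpace ℂ F] (f : E →L[ℂ] F) (Y : Submodule ℂ F) (C : ℝ)
    (hfY : ∀ x, f x ∈ Y) (hC : ∀ y ∈ Y, ∃ x, ‖y - f x‖ ≤ 1 / 2 * ‖y‖ ∧ ‖x‖ ≤ C * ‖y‖) :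
    ∀ y ∈ Y, ∃ x, f x = y ∧ ‖x‖ ≤ 2 * C * ‖y‖ := by
  have hC' : ∀ y : Y, ∃ x, ‖(y : F) - f x‖ ≤ 1 / 2 * ‖(y : F)‖ ∧ ‖x‖ ≤ C * ‖(y : F)‖ :=
    fun y => hC y y.2
  choose g hg using hC'
  let h : Y → Y := fun y => ⟨y - f (g y), Y.sub_mem y.2 (hfY _)⟩
  have hle : ∀ y : Y, ‖(h y : F)‖ ≤ 1 / 2 * ‖(y : F)‖ := fun y => (hg y).1
  intro y0 hy0
  set y : Y := ⟨y0, hy0⟩ with hy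
  have hnle : ∀ n : ℕ, ‖(h^[n] y : F)‖ ≤ (1 / 2) ^ n * ‖(y : F)‖ := by
    intro n
    induction n with
    | zero => simp
    | succ n IH =>
      rw [Function.iterate_succ_apply']
      apply le_trans (hle _) _
      rw [pow_succ', mul_assoc]
      gcongr
  by_cases hy00 : y0 = 0
  · exact ⟨0, by simp [hy00], by simp [hy00]⟩
  have hCn : 0 ≤ C := by
    have h1 := (hg y).2
    have h2 : 0 < ‖(y : F)‖ := norm_pos_iff.2 hy00
    have h3 := norm_nonneg (g y)
    by_contra hh
    nlinarith
  let u : ℕ → E := fun n => g (h^[n] y)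
  have ule : ∀ n, ‖u n‖ ≤ (1 / 2) ^ n * (C * ‖(y : F)‖) := fun n ↦ by
    apply le_trans (hg _).2
    calc
      C * ‖(h^[n] y : F)‖ ≤ C * ((1 / 2) ^ n * ‖(y : F)‖) := by gcongr; exact hnle n
      _ = (1 / 2) ^ n * (C * ‖(y : F)‖) := by ring
  have sNu : Summable fun n => ‖u n‖ := by
    refine .of_nonneg_of_le (fun n => norm_nonneg _) ule ?_
    exact Summable.mul_right _ (summable_geometric_of_lt_one (by simp) (by norm_num))
  have su : Summable u := sNu.of_norm
  let x := tsum u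
  have x_ineq : ‖x‖ ≤ 2 * C * ‖(y : F)‖ :=
    calc
      ‖x‖ ≤ ∑' n, ‖u n‖ := norm_tsum_le_tsum_norm sNu
      _ ≤ ∑' n, (1 / 2) ^ n * (C * ‖(y : F)‖) :=
        sNu.tsum_le_tsum ule <| Summable.mul_right _ summable_geometric_two
      _ = (∑' n, (1 / 2) ^ n) * (C * ‖(y : F)‖) := tsum_mul_right
      _ = 2 * C * ‖(y : F)‖ := by rw [tsum_geometric_two, mul_assoc]
  have fsumeq : ∀ n : ℕ, f (∑ i ∈ Finset.range n, u i) = (y : F) - (h^[n] y : F) := by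
    intro n
    induction n with
    | zero => simp
    | succ n IH =>
      rw [Finset.sum_range_succ, f.map_add, IH, Function.iterate_succ_apply', sub_add]
  have h1 : Filter.Tendsto (fun n => ∑ i ∈ Finset.range n, u i) Filter.atTop (nhds x) :=
    su.hasSum.tendsto_sum_nat
  have L₁ : Filter.Tendsto (fun n => f (∑ i ∈ Finset.range n, u i)) Filter.atTop (nhds (f x)) :=
    (f.continuous.tendsto _).comp h1
  simp only [fsumeq] at L₁
  have L₂ : Filter.Tendsto (fun n => (y : F) - (h^[n] y : F)) Filter.atTop
      (nhds ((y : F) - 0)) := by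
    refine tendsto_const_nhds.sub ?_
    rw [tendsto_iff_norm_sub_tendsto_zero]
    simp only [sub_zero]
    refine squeeze_zero (fun _ => norm_nonneg _) hnle ?_
    rw [← zero_mul ‖(y : F)‖]
    refine (tendsto_pow_atTop_nhds_zero_of_lt_one ?_ ?_).mul tendsto_const_nhds <;> norm_num
  have feq : f x = (y : F) - 0 := tendsto_nhds_unique L₁ L₂
  rw [sub_zero] at feq
  exact ⟨x, feq, x_ineq⟩

/-- One-sided closeness of subspaces. -/
def NearSub {X : Type*} [NormedAddCommGroup X] [NormedSpace ℂ X] (ε : ℝ)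
    (M N : Submodule ℂ X) : Prop :=
  ∀ u ∈ M, ∃ v ∈ N, ‖u - v‖ ≤ ε * ‖u‖

theorem nearSub_of_gapSub {X : Type*} [NormedAddCommGroup X] [NormedSpace ℂ X] {ε : ℝ}
    {M N : Submodule ℂ X} (h : gapSub M N < ε) : NearSub ε M N := by
  intro u hu
  by_cases hu0 : u = 0
  · exact ⟨0, N.zero_mem, by simp [hu0]⟩
  have hn : 0 < ‖u‖ := norm_pos_iff.2 hu0
  set w : X := ((‖u‖⁻¹ : ℝ) : ℂ) • u with hw
  have hw1 : ‖w‖ = 1 := by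
    rw [hw, norm_smul]
    simp [hn.ne']
  have hbdd : BddAbove ((fun u => Metric.infDist u (N : Set X)) '' {u : X | u ∈ M ∧ ‖u‖ = 1}) := by
    refine ⟨1, ?_⟩
    rintro _ ⟨v, ⟨-, hv⟩, rfl⟩
    have := Metric.infDist_le_dist_of_mem (x := v) (show (0 : X) ∈ (N : Set X) from N.zero_mem)
    simpa [hv] using this
  have hlt : Metric.infDist w (N : Set X) < ε :=
    lt_of_le_of_lt (le_csSup hbdd ⟨w, ⟨M.smul_mem _ hu, hw1⟩, rfl⟩) h
  obtain ⟨v, hv, hvd⟩ := (Metric.infDist_lt_iff ⟨0, N.zero_mem⟩).1 hlt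
  refine ⟨(‖u‖ : ℂ) • v, N.smul_mem _ hv, ?_⟩
  have : u - (‖u‖ : ℂ) • v = (‖u‖ : ℂ) • (w - v) := by
    rw [smul_sub, hw, smul_smul]
    congr 1
    have : ((‖u‖ : ℂ) * ((‖u‖⁻¹ : ℝ) : ℂ)) = 1 := by
      push_cast
      exact mul_inv_cancel₀ (by exact_mod_cast hn.ne')
    rw [this, one_smul]
  rw [this, norm_smul, ← dist_eq_norm]
  simp only [Complex.norm_real, norm_norm]
  nlinarith

theorem norm_lin_comb_le {X : Type*} [NormedAddCommGroup X] [NormedSpace ℂ X] {b : ℕ}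
    (c : Fin b → ℂ) (g : Fin b → X) (G : ℝ) (hg : ∀ j, ‖g j‖ ≤ G) :
    ‖∑ j, c j • g j‖ ≤ b * G * ‖c‖ := by
  calc ‖∑ j, c j • g j‖ ≤ ∑ j : Fin b, ‖c‖ * G := by
        refine norm_sum_le_of_le _ fun j _ => ?_
        rw [norm_smul]
        exact mul_le_mul (norm_le_pi_norm c j) (hg j) (norm_nonneg _) (norm_nonneg _)
    _ = b * G * ‖c‖ := by simp; ring

/-- The sum map. -/
noncomputable def sumMap {X : Type*} [NormedAddCommGroup X] [NormedSpace ℂ X]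
    (M N : Submodule ℂ X) {b : ℕ} (g : Fin b → X) : (M × N × (Fin b → ℂ)) →L[ℂ] X :=
  M.subtypeL.comp (ContinuousLinearMap.fst ℂ M (N × (Fin b → ℂ))) +
  (N.subtypeL.comp ((ContinuousLinearMap.fst ℂ N (Fin b → ℂ)).comp
    (ContinuousLinearMap.snd ℂ M (N × (Fin b → ℂ)))) +
  (∑ j, (ContinuousLinearMap.proj (R := ℂ) (φ := fun _ : Fin b => ℂ) j).smulRight (g j)).comp
    ((ContinuousLinearMap.snd ℂ N (Fin b → ℂ)).comp
    (ContinuousLinearMap.snd ℂ M (N × (Fin b → ℂ)))))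

theorem sumMap_apply {X : Type*} [NormedAddCommGroup X] [NormedSpace ℂ X]
    (M N : Submodule ℂ X) {b : ℕ} (g : Fin b → X) (x : M × N × (Fin b → ℂ)) :
    sumMap M N g x = (x.1 : X) + ((x.2.1 : X) + ∑ j, x.2.2 j • g j) := by
  simp [sumMap]

/-- Quantitative surjectivity of the sum map onto `Y`. -/
def SurSub {X : Type*} [NormedAddCommGroup X] [NormedSpace ℂ X]
    (M N : Submodule ℂ X) {b : ℕ} (g : Fin b → X) (Y : Submodule ℂ X) (C : ℝ) : Prop :=
  ∀ y ∈ Y, ∃ x : M × N × (Fin b → ℂ), sumMap M N g x = y ∧ ‖x‖ ≤ C * ‖y‖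

theorem sumMap_mem {X : Type*} [NormedAddCommGroup X] [NormedSpace ℂ X]
    {M N : Submodule ℂ X} {b : ℕ} {g : Fin b → X} {Y : Submodule ℂ X}
    (hM : M ≤ Y) (hN : N ≤ Y) (hg : ∀ j, g j ∈ Y) (x : M × N × (Fin b → ℂ)) :
    sumMap M N g x ∈ Y := by
  rw [sumMap_apply]
  exact Y.add_mem (hM x.1.2) (Y.add_mem (hN x.2.1.2)
    (Y.sum_mem fun j _ => Y.smul_mem _ (hg j)))

theorem surSub_of_surj {X : Type*} [NormedAddCommGroup X] [NormedSpace ℂ X] [CompleteSpace X]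
    {M N : Submodule ℂ X} {b : ℕ} {g : Fin b → X} {Y : Submodule ℂ X}
    (hMc : IsClosed (M : Set X)) (hNc : IsClosed (N : Set X)) (hYc : IsClosed (Y : Set X))
    (hM : M ≤ Y) (hN : N ≤ Y) (hg : ∀ j, g j ∈ Y)
    (hs : ∀ y ∈ Y, ∃ x, sumMap M N g x = y) : ∃ C > 0, SurSub M N g Y C := by
  have := hMc.completeSpace_coe
  have := hNc.completeSpace_coe
  have := hYc.completeSpace_coe
  let f : (M × N × (Fin b → ℂ)) →L[ℂ] Y := (sumMap M N g).codRestrict Y (sumMap_mem hM hN hg)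
  have hf : Function.Surjective f := by
    intro y
    obtain ⟨x, hx⟩ := hs y y.2
    exact ⟨x, Subtype.ext hx⟩
  obtain ⟨C, hC0, hC⟩ := f.exists_preimage_norm_le hf
  refine ⟨C, hC0, fun y hy => ?_⟩
  obtain ⟨x, hx, hxn⟩ := hC ⟨y, hy⟩
  exact ⟨x, congrArg Subtype.val hx, hxn⟩

theorem SurSub.perturb {X : Type*} [NormedAddCommGroup X] [NormedSpace ℂ X] [CompleteSpace X]
    {M N M' N' : Submodule ℂ X} {b : ℕ} {g g' : Fin b → X} {Y Y' : Submodule ℂ X} {C ε : ℝ}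
    (hs : SurSub M N g Y C) (hC : 0 < C)
    (hMc : IsClosed (M' : Set X)) (hNc : IsClosed (N' : Set X))
    (hM : M' ≤ Y') (hN : N' ≤ Y') (hg : ∀ j, g' j ∈ Y')
    (hε0 : 0 < ε) (hε1 : ε ≤ 1) (hε : ε * (1 + 4 * C + 2 * b * C) ≤ 1 / 2)
    (hYY : NearSub ε Y' Y) (hMM : NearSub ε M M') (hNN : NearSub ε N N')
    (hgg : ∀ j, ‖g j - g' j‖ ≤ ε) : SurSub M' N' g' Y' (8 * C) := by
  have := hMc.completeSpace_coe
  have := hNc.completeSpace_coe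
  have key := iter_preimage (sumMap M' N' g') Y' (4 * C) (sumMap_mem hM hN hg) ?_
  · intro y hy
    obtain ⟨x, hx, hxn⟩ := key y hy
    exact ⟨x, hx, by linarith⟩
  intro y' hy'
  obtain ⟨y, hy, hyd⟩ := hYY y' hy'
  obtain ⟨⟨m, n, c⟩, hx, hxn⟩ := hs y hy
  obtain ⟨m', hm', hmd⟩ := hMM m m.2
  obtain ⟨n', hn', hnd⟩ := hNN n n.2
  have hyn : ‖y‖ ≤ 2 * ‖y'‖ := by
    have h1 : ‖y‖ ≤ ‖y'‖ + ‖y' - y‖ := by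
      have := norm_sub_le y' (y' - y); simpa using this
    nlinarith [norm_nonneg y']
  have hxn2 : ‖(m, n, c)‖ ≤ 2 * C * ‖y'‖ := by nlinarith
  have hmn : ‖(m : X)‖ ≤ 2 * C * ‖y'‖ := (norm_fst_le (m, n, c)).trans hxn2
  have hnc : ‖(n, c)‖ ≤ 2 * C * ‖y'‖ := (norm_snd_le (m, n, c)).trans hxn2
  have hnn : ‖(n : X)‖ ≤ 2 * C * ‖y'‖ := (norm_fst_le (n, c)).trans hnc
  have hcn : ‖c‖ ≤ 2 * C * ‖y'‖ := (norm_snd_le (n, c)).trans hnc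
  have bd : ∀ u v : X, ‖u - v‖ ≤ ε * ‖u‖ → ‖u‖ ≤ 2 * C * ‖y'‖ → ‖v‖ ≤ 4 * C * ‖y'‖ := by
    intro u v h1 h2
    have h3 : ‖v‖ ≤ ‖u‖ + ‖u - v‖ := by
      have := norm_sub_le u (u - v); simpa using this
    nlinarith [norm_nonneg u]
  refine ⟨(⟨m', hm'⟩, ⟨n', hn'⟩, c), ?_, ?_⟩
  · rw [sumMap_apply] at hx ⊢
    simp only at hx ⊢
    have e : y' - (m' + (n' + ∑ j, c j • g' j)) =
        (y' - y) + (((m : X) - m') + ((n : X) - n') + ∑ j, c j • (g j - g' j)) := by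
      simp only [smul_sub, Finset.sum_sub_distrib]
      rw [← hx]; abel
    rw [e]
    have hc := norm_lin_comb_le c (fun j => g j - g' j) ε hgg
    have h1 : ε * ‖(m : X)‖ ≤ ε * (2 * C * ‖y'‖) := by gcongr
    have h2 : ε * ‖(n : X)‖ ≤ ε * (2 * C * ‖y'‖) := by gcongr
    have h3 : b * ε * ‖c‖ ≤ b * ε * (2 * C * ‖y'‖) := by gcongr
    calc _ ≤ ‖y' - y‖ + (‖(m : X) - m'‖ + ‖(n : X) - n'‖ + ‖∑ j, c j • (g j - g' j)‖) :=
          (norm_add_le _ _).trans (add_le_add_right ((norm_add_le _ _).trans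
            (add_le_add_left (norm_add_le _ _) _)) _)
      _ ≤ ε * (1 + 4 * C + 2 * b * C) * ‖y'‖ := by linarith
      _ ≤ 1 / 2 * ‖y'‖ := by gcongr
  · refine norm_prod_le_iff.2 ⟨bd _ _ hmd hmn, norm_prod_le_iff.2 ⟨bd _ _ hnd hnn, ?_⟩⟩
    simp only
    nlinarith [norm_nonneg y', mul_nonneg hC.le (norm_nonneg y')]

/-- The enlarged kernel. -/
def kerSub {X : Type*} [NormedAddCommGroup X] [NormedSpace ℂ X]
    (M N : Submodule ℂ X) {b : ℕ} (g : Fin b → X) : Submodule ℂ (X × (Fin b → ℂ)) where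
  carrier := {p | p.1 ∈ M ∧ p.1 + ∑ j, p.2 j • g j ∈ N}
  zero_mem' := by simp
  add_mem' := by
    rintro p q ⟨hp, hp'⟩ ⟨hq, hq'⟩
    refine ⟨M.add_mem hp hq, ?_⟩
    have := N.add_mem hp' hq'
    simp only [Prod.fst_add, Prod.snd_add, Pi.add_apply, add_smul, Finset.sum_add_distrib]
    convert this using 1
    abel
  smul_mem' := by
    rintro a p ⟨hp, hp'⟩
    refine ⟨M.smul_mem _ hp, ?_⟩
    have := N.smul_mem a hp'
    simpa [smul_add, Finset.smul_sum, smul_smul] using this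

theorem mem_kerSub {X : Type*} [NormedAddCommGroup X] [NormedSpace ℂ X]
    {M N : Submodule ℂ X} {b : ℕ} {g : Fin b → X} {p : X × (Fin b → ℂ)} :
    p ∈ kerSub M N g ↔ p.1 ∈ M ∧ p.1 + ∑ j, p.2 j • g j ∈ N := Iff.rfl

theorem kerSub_closed {X : Type*} [NormedAddCommGroup X] [NormedSpace ℂ X]
    {M N : Submodule ℂ X} {b : ℕ} {g : Fin b → X}
    (hMc : IsClosed (M : Set X)) (hNc : IsClosed (N : Set X)) :
    IsClosed (kerSub M N g : Set (X × (Fin b → ℂ))) := by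
  have h1 : IsClosed {p : X × (Fin b → ℂ) | p.1 ∈ (M : Set X)} := hMc.preimage continuous_fst
  have h2 : IsClosed {p : X × (Fin b → ℂ) | p.1 + ∑ j, p.2 j • g j ∈ (N : Set X)} :=
    hNc.preimage (by fun_prop)
  exact h1.inter h2

theorem kerSub_near {X : Type*} [NormedAddCommGroup X] [NormedSpace ℂ X]
    {M N M' N' : Submodule ℂ X} {b : ℕ} {g g' : Fin b → X} {Y : Submodule ℂ X} {C ε G : ℝ}
    (hs : SurSub M N g Y C) (hC : 0 < C) (hM : M ≤ Y) (hN : N ≤ Y) (hg : ∀ j, g j ∈ Y)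
    (hε0 : 0 < ε) (hMM : NearSub ε M' M) (hNN : NearSub ε N' N)
    (hgg : ∀ j, ‖g j - g' j‖ ≤ ε) (hG : ∀ j, ‖g' j‖ ≤ G) :
    NearSub (ε * (1 + C * (2 + b * G + b))) (kerSub M' N' g') (kerSub M N g) := by
  rintro ⟨m', c⟩ ⟨hm', hn'⟩
  simp only at hm' hn'
  set p : X × (Fin b → ℂ) := (m', c) with hp
  have hm'p : ‖m'‖ ≤ ‖p‖ := norm_fst_le p
  have hcp : ‖c‖ ≤ ‖p‖ := norm_snd_le p
  obtain ⟨m, hm, hmd⟩ := hMM m' hm'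
  obtain ⟨n, hn, hnd⟩ := hNN _ hn'
  have hr : m + ∑ j, c j • g j - n ∈ Y :=
    Y.sub_mem (Y.add_mem (hM hm) (Y.sum_mem fun j _ => Y.smul_mem _ (hg j))) (hN hn)
  obtain ⟨⟨m1, n1, c1⟩, hx, hxn⟩ := hs _ hr
  set r := m + ∑ j, c j • g j - n with hrdef
  rw [sumMap_apply] at hx
  simp only at hx
  have e : r = (m' + ∑ j, c j • g' j - n) - (m' - m) + ∑ j, c j • (g j - g' j) := by
    simp only [smul_sub, Finset.sum_sub_distrib, hrdef]
    abel
  have hc1 := norm_lin_comb_le c (fun j => g j - g' j) ε hgg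
  have hc2 := norm_lin_comb_le c g' G hG
  have hrn : ‖r‖ ≤ ε * (2 + b * G + b) * ‖p‖ := by
    have hbG : b * G * ‖c‖ ≤ b * G * ‖p‖ := by
      rcases Nat.eq_zero_or_pos b with h0 | h0
      · simp [h0]
      · have : 0 ≤ G := (norm_nonneg _).trans (hG ⟨0, h0⟩)
        gcongr
    have h0 : ‖m' + ∑ j, c j • g' j‖ ≤ (1 + b * G) * ‖p‖ := by
      have := norm_add_le m' (∑ j, c j • g' j)
      linarith
    have h1 : ε * ‖m' + ∑ j, c j • g' j‖ ≤ ε * ((1 + b * G) * ‖p‖) := by gcongr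
    have h2 : ε * ‖m'‖ ≤ ε * ‖p‖ := by gcongr
    have h3 : b * ε * ‖c‖ ≤ b * ε * ‖p‖ := by gcongr
    rw [e]
    calc _ ≤ ‖m' + ∑ j, c j • g' j - n‖ + ‖m' - m‖ + ‖∑ j, c j • (g j - g' j)‖ :=
          (norm_add_le _ _).trans (add_le_add_left (norm_sub_le _ _) _)
      _ ≤ _ := by linarith
  have hC' : C * ‖r‖ ≤ C * (ε * (2 + b * G + b) * ‖p‖) := by gcongr
  refine ⟨(m - m1, c - c1), ⟨M.sub_mem hm m1.2, ?_⟩, ?_⟩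
  · have e2 : m - (m1 : X) + ∑ j, (c - c1) j • g j = n + n1 := by
      simp only [Pi.sub_apply, sub_smul, Finset.sum_sub_distrib]
      have : m + ∑ j, c j • g j = n + (m1 + (n1 + ∑ j, c1 j • g j)) := by
        rw [hx, hrdef]; abel
      have h3 : m - (m1 : X) + (∑ j, c j • g j - ∑ j, c1 j • g j) =
        (m + ∑ j, c j • g j) - m1 - ∑ j, c1 j • g j := by abel
      rw [h3, this]; abel
    simp only
    rw [e2]
    exact N.add_mem hn n1.2
  · have hm1 : ‖(m1 : X)‖ ≤ C * ‖r‖ := (norm_fst_le (m1, n1, c1)).trans hxn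
    have hc1 : ‖c1‖ ≤ C * ‖r‖ :=
      ((norm_snd_le (n1, c1)).trans (norm_snd_le (m1, n1, c1))).trans hxn
    have hpos : 0 ≤ ε * ‖p‖ := by positivity
    refine norm_prod_le_iff.2 ⟨?_, ?_⟩
    · have e3 : (p - (m - (m1 : X), c - c1)).1 = (m' - m) + m1 := by
        simp [hp]; abel
      rw [e3]
      have h2 : ε * ‖m'‖ ≤ ε * ‖p‖ := by gcongr
      have := norm_add_le (m' - m) (m1 : X)
      linarith
    · have e3 : (p - (m - (m1 : X), c - c1)).2 = c1 := by
        simp [hp]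
      rw [e3]
      linarith

theorem five_dim {A B V W : Type*} [AddCommGroup A] [Module ℂ A] [AddCommGroup B] [Module ℂ B]
    [AddCommGroup V] [Module ℂ V] [AddCommGroup W] [Module ℂ W] [FiniteDimensional ℂ V]
    (f : A →ₗ[ℂ] B) (p : B →ₗ[ℂ] V) (s : V →ₗ[ℂ] W) (hf : Function.Injective f)
    (hfp : LinearMap.range f = LinearMap.ker p) (hps : LinearMap.range p = LinearMap.ker s)
    (hs : Function.Surjective s) :
    FiniteDimensional ℂ W ∧ (FiniteDimensional ℂ A ↔ FiniteDimensional ℂ B) ∧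
    (FiniteDimensional ℂ B → Module.finrank ℂ A + Module.finrank ℂ V =
      Module.finrank ℂ B + Module.finrank ℂ W) := by
  refine ⟨Module.Finite.of_surjective s hs, ⟨fun h => ?_, fun h => ?_⟩, fun h => ?_⟩
  · have h1 : Module.Finite ℂ (LinearMap.ker p) := by
      rw [← hfp]; infer_instance
    have h2 : Module.Finite ℂ (B ⧸ LinearMap.ker p) :=
      Module.Finite.equiv p.quotKerEquivRange.symm
    exact Module.Finite.of_submodule_quotient (LinearMap.ker p)
  · exact Module.Finite.of_injective f hf
  · have e1 := p.finrank_range_add_finrank_ker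
    have e2 := s.finrank_range_add_finrank_ker
    have e3 := LinearMap.finrank_range_of_inj hf
    have e4 : Module.finrank ℂ (LinearMap.range s) = Module.finrank ℂ W := by
      rw [LinearMap.range_eq_top.2 hs]; exact finrank_top ℂ W
    rw [hfp] at e3
    rw [hps] at e1
    omega

theorem kerSub_dim {X : Type*} [NormedAddCommGroup X] [NormedSpace ℂ X]
    {Y₁ M N Y₂ : Submodule ℂ X} {b : ℕ} {g : Fin b → X}
    (h₁ : Y₁ ≤ M ⊓ N) (hg : ∀ j, g j ∈ Y₂)
    (hs : ∀ y ∈ Y₂, ∃ x, sumMap M N g x = y) :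
    QuotFin (M ⊔ N) Y₂ ∧
    (QuotFin Y₁ (M ⊓ N) ↔ QuotFin (Y₁.prod (⊥ : Submodule ℂ (Fin b → ℂ))) (kerSub M N g)) ∧
    (QuotFin (Y₁.prod (⊥ : Submodule ℂ (Fin b → ℂ))) (kerSub M N g) →
      quotFinrank Y₁ (M ⊓ N) + b =
      quotFinrank (Y₁.prod (⊥ : Submodule ℂ (Fin b → ℂ))) (kerSub M N g) +
        quotFinrank (M ⊔ N) Y₂) := by
  set K := kerSub M N g with hK
  set B : Submodule ℂ (X × (Fin b → ℂ)) := Y₁.prod ⊥ with hB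
  let i : ↥(M ⊓ N) →ₗ[ℂ] ↥K :=
    LinearMap.codRestrict K ((LinearMap.inl ℂ X (Fin b → ℂ)).comp (M ⊓ N).subtype) (by
      rintro ⟨u, hu⟩
      exact ⟨hu.1, by simpa using hu.2⟩)
  have hi : ∀ u, ((i u : ↥K) : X × (Fin b → ℂ)) = ((u : X), 0) := fun u => rfl
  have hicomap : Y₁.comap (M ⊓ N).subtype ≤ (B.comap K.subtype).comap i := by
    intro u hu
    exact ⟨hu, rfl⟩
  let f := Submodule.mapQ (Y₁.comap (M ⊓ N).subtype) (B.comap K.subtype) i hicomap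
  let P : ↥K →ₗ[ℂ] (Fin b → ℂ) := (LinearMap.snd ℂ X (Fin b → ℂ)).comp K.subtype
  have hP : B.comap K.subtype ≤ LinearMap.ker P := by
    rintro u ⟨_, hu⟩
    exact hu
  let p := (B.comap K.subtype).liftQ P hP
  let l : (Fin b → ℂ) →ₗ[ℂ] ↥Y₂ := Fintype.linearCombination ℂ (fun j => (⟨g j, hg j⟩ : ↥Y₂))
  have hl : ∀ c, ((l c : ↥Y₂) : X) = ∑ j, c j • g j := by
    intro c
    simp [l, Fintype.linearCombination_apply]
  let s := ((M ⊔ N).comap Y₂.subtype).mkQ.comp l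
  have key := five_dim f p s ?_ ?_ ?_ ?_
  · simpa [QuotFin, quotFinrank] using key
  · rw [injective_iff_map_eq_zero]
    intro x
    obtain ⟨u, rfl⟩ := Submodule.Quotient.mk_surjective _ x
    intro hu
    have hu' : (Submodule.Quotient.mk (i u) : ↥K ⧸ B.comap K.subtype) = 0 := hu
    rw [Submodule.Quotient.mk_eq_zero] at hu' ⊢
    exact hu'.1
  · ext x
    obtain ⟨u, rfl⟩ := Submodule.Quotient.mk_surjective _ x
    constructor
    · rintro ⟨y, hy⟩
      obtain ⟨v, rfl⟩ := Submodule.Quotient.mk_surjective _ y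
      rw [← hy]
      rfl
    · intro hu
      have hu' : (u : X × (Fin b → ℂ)).2 = 0 := hu
      have hu2 := mem_kerSub.1 u.2
      rw [hu'] at hu2
      have hmem : (u : X × (Fin b → ℂ)).1 ∈ M ⊓ N := ⟨hu2.1, by simpa using hu2.2⟩
      refine ⟨Submodule.Quotient.mk ⟨_, hmem⟩, ?_⟩
      have : i ⟨_, hmem⟩ = u := Subtype.ext (Prod.ext rfl hu'.symm)
      change Submodule.Quotient.mk (i ⟨_, hmem⟩) = _
      rw [this]
  · ext c
    have hsc : c ∈ LinearMap.ker s ↔ ∑ j, c j • g j ∈ M ⊔ N := by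
      rw [← hl, LinearMap.mem_ker]
      exact Submodule.Quotient.mk_eq_zero _
    rw [hsc]
    constructor
    · rintro ⟨x, hx⟩
      obtain ⟨u, rfl⟩ := Submodule.Quotient.mk_surjective _ x
      have hx' : (u : X × (Fin b → ℂ)).2 = c := hx
      have hu2 := mem_kerSub.1 u.2
      rw [hx'] at hu2
      have := (M ⊔ N).sub_mem (Submodule.mem_sup_right hu2.2) (Submodule.mem_sup_left hu2.1)
      simpa using this
    · intro hc
      obtain ⟨m, hm, n, hn, hmn⟩ := Submodule.mem_sup.1 hc
      refine ⟨Submodule.Quotient.mk ⟨(-m, c), M.neg_mem hm, ?_⟩, rfl⟩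
      simp only
      rw [← hmn]
      simpa using hn
  · intro x
    obtain ⟨y, rfl⟩ := Submodule.Quotient.mk_surjective _ x
    obtain ⟨⟨m, n, c⟩, hx⟩ := hs y y.2
    rw [sumMap_apply] at hx
    refine ⟨c, ?_⟩
    refine (Submodule.Quotient.eq _).2 ?_
    change ((l c - y : ↥Y₂) : X) ∈ M ⊔ N
    have : ((l c - y : ↥Y₂) : X) = -(m + n : X) := by
      rw [Submodule.coe_sub, hl, ← hx]; simp only; abel
    rw [this]
    exact (M ⊔ N).neg_mem (Submodule.add_mem_sup m.2 n.2)

theorem sup_closed {X : Type*} [NormedAddCommGroup X] [NormedSpace ℂ X] [CompleteSpace X]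
    {M N : Submodule ℂ X} {b : ℕ} {g : Fin b → X} {Y : Submodule ℂ X}
    (hMc : IsClosed (M : Set X)) (hNc : IsClosed (N : Set X)) (hYc : IsClosed (Y : Set X))
    (hM : M ≤ Y) (hN : N ≤ Y) (hg : ∀ j, g j ∈ Y)
    (hs : ∀ y ∈ Y, ∃ x, sumMap M N g x = y) : IsClosed ((M ⊔ N : Submodule ℂ X) : Set X) := by
  have := hMc.completeSpace_coe
  have := hNc.completeSpace_coe
  have := hYc.completeSpace_coe
  let f : (M × N × (Fin b → ℂ)) →L[ℂ] Y := (sumMap M N g).codRestrict Y (sumMap_mem hM hN hg)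
  have hf : Function.Surjective f := by
    intro y
    obtain ⟨x, hx⟩ := hs y y.2
    exact ⟨x, Subtype.ext hx⟩
  have hq := f.isQuotientMap hf
  let Q : Submodule ℂ (Fin b → ℂ) := (M ⊔ N).comap (Fintype.linearCombination ℂ g)
  have hQc : IsClosed (Q : Set (Fin b → ℂ)) := Q.closed_of_finiteDimensional
  have h1 : IsClosed (((M ⊔ N).comap Y.subtype : Submodule ℂ Y) : Set Y) := by
    rw [← hq.isClosed_preimage]
    have : f ⁻¹' (((M ⊔ N).comap Y.subtype : Submodule ℂ Y) : Set Y) =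
        (fun x : M × N × (Fin b → ℂ) => x.2.2) ⁻¹' (Q : Set (Fin b → ℂ)) := by
      ext ⟨m, n, c⟩
      change sumMap M N g (m, n, c) ∈ M ⊔ N ↔ Fintype.linearCombination ℂ g c ∈ M ⊔ N
      rw [sumMap_apply, Fintype.linearCombination_apply, ← add_assoc]
      exact Submodule.add_mem_iff_right _ (Submodule.add_mem_sup m.2 n.2)
    rw [this]
    exact hQc.preimage (by fun_prop)
  have h2 := hYc.isClosedEmbedding_subtypeVal.isClosedMap _ h1
  convert h2 using 1
  ext x
  constructor
  · intro hx
    exact ⟨⟨x, sup_le hM hN hx⟩, hx, rfl⟩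
  · rintro ⟨y, hy, rfl⟩
    exact hy

theorem exists_small (A t : ℝ) (ht : 0 < t) : ∃ ε > (0 : ℝ), ε ≤ 1 ∧ ε * A ≤ t := by
  refine ⟨min 1 (t / (|A| + 1)), by positivity, min_le_left _ _, ?_⟩
  have h1 : min 1 (t / (|A| + 1)) ≤ t / (|A| + 1) := min_le_right _ _
  have h0 : 0 < min 1 (t / (|A| + 1)) := by positivity
  calc _ ≤ min 1 (t / (|A| + 1)) * (|A| + 1) := by
        gcongr; linarith [le_abs_self A]
    _ ≤ t / (|A| + 1) * (|A| + 1) := by gcongr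
    _ = t := by field_simp

theorem NearSub.mono {X : Type*} [NormedAddCommGroup X] [NormedSpace ℂ X] {ε η : ℝ}
    {M N : Submodule ℂ X} (h : NearSub ε M N) (hη : ε ≤ η) : NearSub η M N := by
  intro u hu
  obtain ⟨v, hv, hd⟩ := h u hu
  exact ⟨v, hv, hd.trans (by gcongr)⟩

/-- Perturbed generators. -/
theorem NearSub.family {X : Type*} [NormedAddCommGroup X] [NormedSpace ℂ X] {ε G : ℝ}
    {M N : Submodule ℂ X} (h : NearSub ε M N) (hε : 0 < ε) {b : ℕ} (g : Fin b → X)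
    (hg : ∀ j, g j ∈ M) (hG : ∀ j, ‖g j‖ ≤ G) :
    ∃ g' : Fin b → X, (∀ j, g' j ∈ N) ∧ ∀ j, ‖g j - g' j‖ ≤ ε * G := by
  have : ∀ j, ∃ v ∈ N, ‖g j - v‖ ≤ ε * G := fun j => by
    obtain ⟨v, hv, hd⟩ := h _ (hg j)
    exact ⟨v, hv, hd.trans (by gcongr; exact hG j)⟩
  choose g' h1 h2 using this
  exact ⟨g', h1, h2⟩

theorem exists_bound {X : Type*} [NormedAddCommGroup X] {b : ℕ} (g : Fin b → X) :
    ∃ G > (0 : ℝ), ∀ j, ‖g j‖ ≤ G :=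
  ⟨∑ j, ‖g j‖ + 1, by positivity, fun j => by
    have := Finset.single_le_sum (f := fun j => ‖g j‖) (fun i _ => norm_nonneg _)
      (Finset.mem_univ j)
    linarith⟩

/-- A basis of the quotient, lifted. -/
theorem exists_gens {X : Type*} [NormedAddCommGroup X] [NormedSpace ℂ X]
    {A B : Submodule ℂ X} (h : QuotFin A B) :
    ∃ a : ℕ, quotFinrank A B = a ∧ ∃ k : Fin a → X, (∀ j, k j ∈ B) ∧
      (∀ y ∈ B, ∃ c : Fin a → ℂ, y - ∑ j, c j • k j ∈ A) ∧
      (∀ c : Fin a → ℂ, ∑ j, c j • k j ∈ A → c = 0) := by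
  unfold QuotFin at h
  let bs := Module.finBasis ℂ (↥B ⧸ A.comap B.subtype)
  have : ∀ j, ∃ u : ↥B, (A.comap B.subtype).mkQ u = bs j :=
    fun j => Submodule.mkQ_surjective _ _
  choose k hk using this
  refine ⟨Module.finrank ℂ (↥B ⧸ A.comap B.subtype), rfl, fun j => (k j : X), fun j => (k j).2, fun y hy => ?_, fun c hc => ?_⟩
  · let q := (A.comap B.subtype).mkQ ⟨y, hy⟩
    refine ⟨fun j => bs.repr q j, ?_⟩
    have h1 : (A.comap B.subtype).mkQ (⟨y, hy⟩ - ∑ j, bs.repr q j • k j) = 0 := by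
      rw [map_sub, map_sum]
      simp only [map_smul, hk]
      rw [bs.sum_repr]
      exact sub_self _
    have h2 := (Submodule.Quotient.mk_eq_zero _).1 h1
    have h3 : ((⟨y, hy⟩ - ∑ j, bs.repr q j • k j : ↥B) : X) ∈ A := h2
    simpa using h3
  · have h3 : ((∑ j, c j • k j : ↥B) : X) ∈ A := by simpa using hc
    have h1 : (A.comap B.subtype).mkQ (∑ j, c j • k j) = 0 :=
      (Submodule.Quotient.mk_eq_zero _).2 h3
    rw [map_sum] at h1
    simp only [map_smul, hk] at h1
    exact funext (Fintype.linearIndependent_iff.1 bs.linearIndependent c h1)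

theorem quot_of_gens {X : Type*} [NormedAddCommGroup X] [NormedSpace ℂ X]
    {A B : Submodule ℂ X} {a : ℕ} (k : Fin a → X) (hk : ∀ j, k j ∈ B)
    (hsp : ∀ y ∈ B, ∃ c : Fin a → ℂ, y - ∑ j, c j • k j ∈ A)
    (hind : ∀ c : Fin a → ℂ, ∑ j, c j • k j ∈ A → c = 0) :
    QuotFin A B ∧ quotFinrank A B = a := by
  let l : (Fin a → ℂ) →ₗ[ℂ] ↥B := Fintype.linearCombination ℂ (fun j => (⟨k j, hk j⟩ : ↥B))
  have hl : ∀ c, ((l c : ↥B) : X) = ∑ j, c j • k j := by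
    intro c
    simp [l, Fintype.linearCombination_apply]
  let s := (A.comap B.subtype).mkQ.comp l
  have hinj : Function.Injective s := by
    rw [injective_iff_map_eq_zero]
    intro c hc
    have h2 : l c ∈ A.comap B.subtype := (Submodule.Quotient.mk_eq_zero _).1 hc
    rw [Submodule.mem_comap, Submodule.subtype_apply] at h2
    rw [hl] at h2
    exact hind c h2
  have hsur : Function.Surjective s := by
    intro x
    obtain ⟨y, rfl⟩ := Submodule.Quotient.mk_surjective _ x
    obtain ⟨c, hc⟩ := hsp y y.2
    refine ⟨c, ((Submodule.Quotient.eq _).2 ?_).symm⟩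
    change ((y - l c : ↥B) : X) ∈ A
    rw [Submodule.coe_sub, hl]
    exact hc
  refine ⟨Module.Finite.of_surjective s hsur, ?_⟩
  have := (LinearEquiv.ofBijective s ⟨hinj, hsur⟩).finrank_eq
  rw [Module.finrank_fin_fun] at this
  exact this.symm

theorem quot_stable {X : Type*} [NormedAddCommGroup X] [NormedSpace ℂ X] [CompleteSpace X]
    {Y K : Submodule ℂ X} (hYc : IsClosed (Y : Set X)) (hKc : IsClosed (K : Set X))
    (hYK : Y ≤ K) (hfin : QuotFin Y K) :
    ∃ η > (0 : ℝ), ∀ Y' K' : Submodule ℂ X, IsClosed (Y' : Set X) → Y' ≤ K' →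
      NearSub η Y' Y → NearSub η Y Y' → NearSub η K' K → NearSub η K K' →
      QuotFin Y' K' ∧ quotFinrank Y' K' = quotFinrank Y K := by
  obtain ⟨a, ha, k, hk, hsp, hind⟩ := exists_gens hfin
  rw [ha]
  have hbotc : IsClosed ((⊥ : Submodule ℂ X) : Set X) := by simp
  obtain ⟨C, hC, hS⟩ := surSub_of_surj (M := Y) (N := ⊥) (g := k) (Y := K) hYc hbotc hKc hYK
    bot_le hk (by
      intro y hy
      obtain ⟨c, hc⟩ := hsp y hy
      refine ⟨(⟨_, hc⟩, 0, c), ?_⟩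
      rw [sumMap_apply]
      simp)
  obtain ⟨G, hG0, hG⟩ := exists_bound k
  obtain ⟨ε, hε0, hε1, hε⟩ := exists_small
    ((1 + 4 * C + 2 * a * C) + C * a * (G + 2)) (1 / 2) (by norm_num)
  have hA1 : 0 ≤ ε * (1 + 4 * C + 2 * a * C) := by positivity
  have hA2 : 0 ≤ ε * (C * a * (G + 2)) := by positivity
  rw [mul_add] at hε
  refine ⟨ε / (G + 1), by positivity, fun Y' K' hY'c hYK' n1 n2 n3 n4 => ?_⟩
  have hη : ε / (G + 1) ≤ ε := div_le_self hε0.le (by linarith)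
  obtain ⟨k', hk', hkk0⟩ := n4.family (by positivity) k hk hG
  have hkk : ∀ j, ‖k j - k' j‖ ≤ ε := fun j => (hkk0 j).trans (by
    rw [div_mul_eq_mul_div, div_le_iff₀ (by positivity)]
    nlinarith)
  have hS' := hS.perturb (M' := Y') (N' := ⊥) (g' := k') (Y' := K') hC hY'c hbotc hYK' bot_le hk'
    hε0 hε1 (by linarith) (n3.mono hη) (n2.mono hη)
    (fun u hu => ⟨u, hu, by simp; positivity⟩) hkk
  refine quot_of_gens k' hk' ?_ ?_
  · intro y hy
    obtain ⟨⟨m, n, c⟩, hx, -⟩ := hS' y hy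
    refine ⟨c, ?_⟩
    rw [sumMap_apply] at hx
    have hn : (n : X) = 0 := (Submodule.mem_bot ℂ).1 n.2
    simp only [hn] at hx
    rw [← hx]
    simp
  · intro c hc
    obtain ⟨y, hy, hyd⟩ := (n1.mono hη) _ hc
    have hr : (∑ j, c j • k j) - y ∈ K :=
      K.sub_mem (K.sum_mem fun j _ => K.smul_mem _ (hk j)) (hYK hy)
    obtain ⟨⟨y1, n, c1⟩, hx, hxn⟩ := hS _ hr
    have hc1n : ‖c1‖ ≤ C * ‖(∑ j, c j • k j) - y‖ :=
      ((norm_snd_le (n, c1)).trans (norm_snd_le (y1, n, c1))).trans hxn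
    rw [sumMap_apply] at hx
    have hn : (n : X) = 0 := (Submodule.mem_bot ℂ).1 n.2
    simp only [hn, zero_add] at hx
    have hcc : c - c1 = 0 := by
      apply hind
      have : ∑ j, (c - c1) j • k j = y1 + y := by
        simp only [Pi.sub_apply, sub_smul, Finset.sum_sub_distrib]
        have h2 : ∑ j, c j • k j = (y1 + ∑ j, c1 j • k j) + y := by rw [hx]; abel
        rw [h2]; abel
      rw [this]
      exact Y.add_mem y1.2 hy
    have hcc' : c1 = c := (sub_eq_zero.1 hcc).symm
    rw [hcc'] at hc1n
    have hk'G : ∀ j, ‖k' j‖ ≤ G + 1 := fun j => by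
      have h1 : ‖k' j‖ ≤ ‖k j‖ + ‖k j - k' j‖ := by
        have := norm_sub_le (k j) (k j - k' j); simpa using this
      linarith [hG j, hkk j]
    have b1 := norm_lin_comb_le c k' (G + 1) hk'G
    have b2 := norm_lin_comb_le c (fun j => k j - k' j) ε hkk
    have e : (∑ j, c j • k j) - y = (∑ j, c j • k' j - y) + ∑ j, c j • (k j - k' j) := by
      simp only [smul_sub, Finset.sum_sub_distrib]; abel
    have b3 : ‖(∑ j, c j • k j) - y‖ ≤ ε * (a * (G + 2)) * ‖c‖ := by
      rw [e]
      have h1 := norm_add_le (∑ j, c j • k' j - y) (∑ j, c j • (k j - k' j))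
      have h2 : ε * ‖∑ j, c j • k' j‖ ≤ ε * (a * (G + 1) * ‖c‖) := by gcongr
      linarith
    have b4 : C * ‖(∑ j, c j • k j) - y‖ ≤ C * (ε * (a * (G + 2)) * ‖c‖) := by gcongr
    have b5 : ε * (C * a * (G + 2)) * ‖c‖ ≤ 1 / 2 * ‖c‖ := by
      gcongr; linarith
    have b6 : ‖c‖ ≤ 0 := by linarith
    exact norm_le_zero_iff.1 b6

theorem NearSub.prod_bot {X : Type*} [NormedAddCommGroup X] [NormedSpace ℂ X] {ε : ℝ}
    {M N : Submodule ℂ X} (h : NearSub ε M N) (b : ℕ) :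
    NearSub ε (M.prod (⊥ : Submodule ℂ (Fin b → ℂ))) (N.prod ⊥) := by
  rintro ⟨u, c⟩ ⟨hu, hc⟩
  have hc0 : c = 0 := (Submodule.mem_bot ℂ).1 hc
  obtain ⟨v, hv, hd⟩ := h u hu
  refine ⟨(v, 0), ⟨hv, by simp⟩, ?_⟩
  subst hc0
  simpa [Prod.norm_def] using hd

theorem tetradIndex_eq {X : Type*} [NormedAddCommGroup X] [NormedSpace ℂ X]
    {Y₁ M N Y₂ : Submodule ℂ X} (h1 : QuotFin Y₁ (M ⊓ N)) (h2 : QuotFin (M ⊔ N) Y₂) :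
    tetradIndex Y₁ M N Y₂ =
      (((quotFinrank Y₁ (M ⊓ N) : ℝ) - (quotFinrank (M ⊔ N) Y₂ : ℝ) : ℝ) : EReal) := by
  simp [tetradIndex, eQuotDim, h1, h2]

/-- Stability of the index of a Fredholm tetrad with respect
to the symmetric gaps: a tetrad near a Fredholm tetrad is Fredholm, with the
same index. -/
theorem stable_tetrad_index_eq {X : Type*} [NormedAddCommGroup X] [NormedSpace ℂ X]
    [CompleteSpace X] (Y₁ M N Y₂ : Submodule ℂ X)
    (hY₁c : IsClosed (Y₁ : Set X)) (hMc : IsClosed (M : Set X))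
    (hNc : IsClosed (N : Set X)) (hY₂c : IsClosed (Y₂ : Set X))
    (hMNc : IsClosed ((M ⊔ N : Submodule ℂ X) : Set X))
    (h₁ : Y₁ ≤ M ⊓ N) (h₂ : M ⊔ N ≤ Y₂)
    (hfin₁ : QuotFin Y₁ (M ⊓ N)) (hfin₂ : QuotFin (M ⊔ N) Y₂) :
    ∃ ε > (0 : ℝ), ∀ Y₁' M' N' Y₂' : Submodule ℂ X,
      IsClosed (Y₁' : Set X) → IsClosed (M' : Set X) → IsClosed (N' : Set X) →
      IsClosed (Y₂' : Set X) →
      Y₁' ≤ M' ⊓ N' → M' ⊔ N' ≤ Y₂' →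
      hatGap Y₁' Y₁ < ε → hatGap M' M < ε → hatGap N' N < ε → hatGap Y₂' Y₂ < ε →
      IsClosed ((M' ⊔ N' : Submodule ℂ X) : Set X) ∧
        QuotFin Y₁' (M' ⊓ N') ∧ QuotFin (M' ⊔ N') Y₂' ∧
        tetradIndex Y₁' M' N' Y₂' = tetradIndex Y₁ M N Y₂ := by
  obtain ⟨b, -, g, hg, hsp, -⟩ := exists_gens hfin₂
  have hM : M ≤ Y₂ := le_sup_left.trans h₂
  have hN : N ≤ Y₂ := le_sup_right.trans h₂
  have hsur : ∀ y ∈ Y₂, ∃ x, sumMap M N g x = y := by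
    intro y hy
    obtain ⟨c, hc⟩ := hsp y hy
    obtain ⟨m, hm, n, hn, hmn⟩ := Submodule.mem_sup.1 hc
    refine ⟨(⟨m, hm⟩, ⟨n, hn⟩, c), ?_⟩
    rw [sumMap_apply]
    simp only
    rw [← add_assoc, hmn]
    abel
  obtain ⟨C, hC, hS⟩ := surSub_of_surj hMc hNc hY₂c hM hN hg hsur
  obtain ⟨G, hG0, hG⟩ := exists_bound g
  obtain ⟨-, hiff, hdim⟩ := kerSub_dim h₁ hg hsur
  have hKfin := hiff.1 hfin₁
  have hdim0 := hdim hKfin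
  have hprodc : ∀ Z : Submodule ℂ X, IsClosed (Z : Set X) →
      IsClosed ((Z.prod (⊥ : Submodule ℂ (Fin b → ℂ)) : Submodule ℂ (X × (Fin b → ℂ))) :
        Set (X × (Fin b → ℂ))) := by
    intro Z hZ
    rw [Submodule.prod_coe]
    exact hZ.prod (by simp)
  have hle : ∀ Z A B : Submodule ℂ X, ∀ g : Fin b → X, Z ≤ A ⊓ B →
      Z.prod (⊥ : Submodule ℂ (Fin b → ℂ)) ≤ kerSub A B g := by
    rintro Z A B g hZ ⟨u, c⟩ ⟨hu, hc⟩
    have hc0 : c = 0 := (Submodule.mem_bot ℂ).1 hc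
    subst hc0
    exact ⟨(hZ hu).1, by simpa using (hZ hu).2⟩
  obtain ⟨η, hη0, hη⟩ := quot_stable (hprodc Y₁ hY₁c) (kerSub_closed (g := g) hMc hNc)
    (hle Y₁ M N g h₁) hKfin
  obtain ⟨ε, hε0, hε1, hε⟩ := exists_small
    ((1 + 4 * C + 2 * b * C) / (1 / 2) + (1 + 8 * C * (2 + b * (G + 1) + b)) / η) 1 one_pos
  have hA1 : 0 ≤ ε * ((1 + 4 * C + 2 * b * C) / (1 / 2)) := by positivity
  have hA2 : 0 ≤ ε * ((1 + 8 * C * (2 + b * (G + 1) + b)) / η) := by positivity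
  rw [mul_add] at hε
  have hε2 : ε * (1 + 4 * C + 2 * b * C) ≤ 1 / 2 := by linarith
  have hε3 : ε * (1 + 8 * C * (2 + b * (G + 1) + b)) ≤ η := by
    have h1 : ε * ((1 + 8 * C * (2 + b * (G + 1) + b)) / η) ≤ 1 := by linarith
    rwa [← mul_div_assoc, div_le_one hη0] at h1
  have hpos : (0 : ℝ) ≤ 2 + b * (G + 1) + b := by positivity
  have hεη : ε ≤ η := by
    have : 0 ≤ ε * (8 * C * (2 + b * (G + 1) + b)) := by positivity
    linarith
  refine ⟨ε / (G + 1), by positivity, ?_⟩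
  intro Y₁' M' N' Y₂' hY₁'c hM'c hN'c hY₂'c h₁' h₂' d1 d2 d3 d4
  have hγ : ε / (G + 1) ≤ ε := div_le_self hε0.le (by linarith)
  have near : ∀ A B : Submodule ℂ X, hatGap A B < ε / (G + 1) →
      NearSub ε A B ∧ NearSub ε B A := fun A B h =>
    ⟨(nearSub_of_gapSub ((le_max_left _ _).trans_lt h)).mono hγ,
      (nearSub_of_gapSub ((le_max_right _ _).trans_lt h)).mono hγ⟩
  obtain ⟨g', hg', hgg0⟩ := (nearSub_of_gapSub ((le_max_right _ _).trans_lt d4)).family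
    (by positivity) g hg hG
  have hgg : ∀ j, ‖g j - g' j‖ ≤ ε := fun j => (hgg0 j).trans (by
    rw [div_mul_eq_mul_div, div_le_iff₀ (by positivity)]
    nlinarith)
  have hgg' : ∀ j, ‖g' j - g j‖ ≤ ε := fun j => by rw [norm_sub_rev]; exact hgg j
  have hG' : ∀ j, ‖g' j‖ ≤ G + 1 := fun j => by
    have h1 : ‖g' j‖ ≤ ‖g j‖ + ‖g j - g' j‖ := by
      have := norm_sub_le (g j) (g j - g' j); simpa using this
    linarith [hG j, hgg j]
  have hM' : M' ≤ Y₂' := le_sup_left.trans h₂'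
  have hN' : N' ≤ Y₂' := le_sup_right.trans h₂'
  have hS' := hS.perturb hC hM'c hN'c hM' hN' hg' hε0 hε1 hε2 (near _ _ d4).1 (near _ _ d2).2
    (near _ _ d3).2 hgg
  have hsur' : ∀ y ∈ Y₂', ∃ x, sumMap M' N' g' x = y := fun y hy => by
    obtain ⟨x, hx, -⟩ := hS' y hy
    exact ⟨x, hx⟩
  have k1 := (kerSub_near hS hC hM hN hg hε0 (near _ _ d2).1 (near _ _ d3).1 hgg hG').mono
    (show _ ≤ η from le_trans (by
      gcongr
      linarith) hε3)
  have k2 := (kerSub_near hS' (by positivity) hM' hN' hg' hε0 (near _ _ d2).2 (near _ _ d3).2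
    hgg' (fun j => (hG j).trans (by linarith : G ≤ G + 1))).mono hε3
  obtain ⟨q1, q2⟩ := hη _ _ (hprodc Y₁' hY₁'c) (hle Y₁' M' N' g' h₁')
    (((near _ _ d1).1.mono hεη).prod_bot b) (((near _ _ d1).2.mono hεη).prod_bot b) k1 k2
  obtain ⟨f2, hiff', hdim'⟩ := kerSub_dim h₁' hg' hsur'
  have f1 := hiff'.2 q1
  have hdim1 := hdim' q1
  refine ⟨sup_closed hM'c hN'c hY₂'c hM' hN' hg' hsur', f1, f2, ?_⟩
  rw [tetradIndex_eq f1 f2, tetradIndex_eq hfin₁ hfin₂]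
  rw [q2] at hdim1
  congr 1
  have e0 := congrArg (fun n : ℕ => (n : ℝ)) hdim0
  have e1 := congrArg (fun n : ℕ => (n : ℝ)) hdim1
  push_cast at e0 e1
  linarith
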